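/- Initiality of the semantic λ-calculus among exponential monads: an exponential monad is a monad R on Type equipped with R-linear morphisms absR : ∀ X, R (Option X) → R X and app1R : ∀ X, R X → R (Option X) (linearity: absR (bind (comm_R f) t) = bind f (absR t) and app1R (bind f t) = bind (comm_R f) (app1R t) for all f : X → R Y) that are mutually inverse: absR (app1R x) = x and app1R (absR t) = t. Let Λ X be the quotient of term X by βη-equivalence, with its monad structure induced by var and subst, its abstraction abs̄ induced by abs, and app1̄ induced by app1 x := app (shift x) (var none); then (Λ, abs̄, app1̄) is an exponential monad, and it is initial: for every exponential monad (R, absR, app1R) there exists a unique family φ_X : Λ X → R X that is a morphism of monads and satisfies φ (abs̄ t) = absR (φ t) and φ (app1̄ x) = app1R (φ x). -/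

import Mathlib

universe u

structure MonadOn : Type (u + 1) where
  F : Type u → Type u
  unit : ∀ X : Type u, X → F X
  bind : ∀ X Y : Type u, (X → F Y) → F X → F Y
  bind_bind : ∀ (X Y Z : Type u) (f : X → F Y) (g : Y → F Z) (x : F X),
    bind Y Z g (bind X Y f x) = bind X Z (fun u => bind Y Z g (f u)) x
  bind_unit : ∀ (X Y : Type u) (f : X → F Y) (x : X), bind X Y f (unit X x) = f x
  unit_bind : ∀ (X : Type u) (x : F X), bind X X (unit X) x = x

/-- `comm_R f : Option X → R (Option Y)` for `f : X → R Y`. -/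
def MonadOn.comm (R : MonadOn.{u}) {X Y : Type u} (f : X → R.F Y) :
    Option X → R.F (Option Y)
  | some a => R.bind Y (Option Y) (fun y => R.unit (Option Y) (some y)) (f a)
  | none => R.unit (Option Y) none

/-- Untyped λ-terms with free variables in `X`, in the nested-datatype
(locally nameless / de Bruijn) encoding. -/
inductive term : Type u → Type (u + 1)
  | var {X : Type u} : X → term X
  | app {X : Type u} : term X → term X → term X
  | abs {X : Type u} : term (Option X) → term X

/-- Renaming of free variables. -/
def fct {X Y : Type u} (f : X → Y) : term X → term Y
  | .var x => .var (f x)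
  | .app t u => .app (fct f t) (fct f u)
  | .abs t => .abs (fct (Option.map f) t)

/-- Weakening. -/
def shift {X : Type u} (t : term X) : term (Option X) :=
  fct some t

def tcomm {X Y : Type u} (f : X → term Y) : Option X → term (Option Y)
  | some a => shift (f a)
  | none => .var none

/-- Simultaneous substitution of free variables. -/
def subst {X Y : Type u} (f : X → term Y) : term X → term Y
  | .var x => f x
  | .app t u => .app (subst f t) (subst f u)
  | .abs t => .abs (subst (tcomm f) t)

/-- The map sending `none` to `u` and `some a` to `var a`;
`t[u] := subst (sub1 u) t`. -/
def sub1 {X : Type u} (u : term X) : Option X → term X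
  | none => u
  | some a => .var a

/-- βη-equivalence on λ-terms. -/
inductive lcr : {X : Type u} → term X → term X → Prop
  | var {X : Type u} (a : X) : lcr (.var a) (.var a)
  | app {X : Type u} {x₁ x₂ y₁ y₂ : term X} :
      lcr x₁ x₂ → lcr y₁ y₂ → lcr (.app x₁ y₁) (.app x₂ y₂)
  | abs {X : Type u} {x y : term (Option X)} : lcr x y → lcr (.abs x) (.abs y)
  | beta {X : Type u} (t : term (Option X)) (u : term X) :
      lcr (.app (.abs t) u) (subst (sub1 u) t)
  | eta {X : Type u} (t : term X) : lcr (.abs (.app (shift t) (.var none))) t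
  | sym {X : Type u} {x y : term X} : lcr y x → lcr x y
  | trans {X : Type u} {x y z : term X} : lcr x y → lcr y z → lcr x z

/-- The semantic λ-calculus: λ-terms modulo βη-equivalence. -/
def Lam (X : Type u) : Type (u + 1) := Quot (@lcr.{u} X)

def lmk {X : Type u} : term X → Lam X := Quot.mk _

/-- `app1 x := app (shift x) (var none)`. -/
def app1 {X : Type u} (x : term X) : term (Option X) :=
  .app (shift x) (.var none)

/-! ### Renaming and substitution on terms -/

theorem fct_fct {X Y Z : Type u} (f : X → Y) (g : Y → Z) (t : term X) :
    fct g (fct f t) = fct (g ∘ f) t := by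
  induction t generalizing Y Z with
  | var x => rfl
  | app t s iht ihs => simp only [fct, iht, ihs]
  | abs t ih => simp only [fct, ih, Option.map_comp_map]

theorem fct_some_shift {X Y : Type u} (f : X → Y) (t : term X) :
    fct (Option.map f) (shift t) = shift (fct f t) := by
  simp only [shift, fct_fct]
  rfl

theorem tcomm_comp {X Y Z : Type u} (f : X → Y) (g : Y → term Z) :
    tcomm g ∘ Option.map f = tcomm (g ∘ f) := by
  funext o
  cases o <;> rfl

theorem subst_fct {X Y Z : Type u} (f : X → Y) (g : Y → term Z) (t : term X) :
    subst g (fct f t) = subst (g ∘ f) t := by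
  induction t generalizing Y Z with
  | var x => rfl
  | app t s iht ihs => simp only [fct, subst, iht, ihs]
  | abs t ih => simp only [fct, subst, ih, tcomm_comp]

theorem fct_comp_tcomm {X Y Z : Type u} (f : X → term Y) (g : Y → Z) :
    fct (Option.map g) ∘ tcomm f = tcomm (fct g ∘ f) := by
  funext o
  cases o with
  | none => rfl
  | some a => exact fct_some_shift g (f a)

theorem fct_subst {X Y Z : Type u} (f : X → term Y) (g : Y → Z) (t : term X) :
    fct g (subst f t) = subst (fct g ∘ f) t := by
  induction t generalizing Y Z with
  | var x => rfl
  | app t s iht ihs => simp only [fct, subst, iht, ihs]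
  | abs t ih => simp only [fct, subst, ih, fct_comp_tcomm]

theorem subst_tcomm_shift {X Y : Type u} (f : X → term Y) (t : term X) :
    subst (tcomm f) (shift t) = shift (subst f t) := by
  simp only [shift, subst_fct, fct_subst]
  rfl

theorem subst_comp_tcomm {X Y Z : Type u} (f : X → term Y) (g : Y → term Z) :
    subst (tcomm g) ∘ tcomm f = tcomm (subst g ∘ f) := by
  funext o
  cases o with
  | none => rfl
  | some a => exact subst_tcomm_shift g (f a)

theorem subst_subst {X Y Z : Type u} (f : X → term Y) (g : Y → term Z) (t : term X) :
    subst g (subst f t) = subst (subst g ∘ f) t := by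
  induction t generalizing Y Z with
  | var x => rfl
  | app t s iht ihs => simp only [subst, iht, ihs]
  | abs t ih => simp only [subst, ih, subst_comp_tcomm]

theorem tcomm_var {X : Type u} : tcomm (term.var : X → term X) = term.var := by
  funext o
  cases o <;> rfl

theorem subst_var {X : Type u} (t : term X) : subst term.var t = t := by
  induction t with
  | var x => rfl
  | app t s iht ihs => simp only [subst, iht, ihs]
  | abs t ih => simp only [subst, tcomm_var, ih]

theorem fct_eq_subst {X Y : Type u} (f : X → Y) (t : term X) :
    fct f t = subst (term.var ∘ f) t := by
  rw [← subst_fct, subst_var]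

theorem subst_sub1_shift {X : Type u} (t u : term X) : subst (sub1 u) (shift t) = t :=
  (subst_fct some (sub1 u) t).trans (subst_var t)

theorem subst_sub1 {X Y : Type u} (f : X → term Y) (t : term (Option X)) (u : term X) :
    subst f (subst (sub1 u) t) = subst (sub1 (subst f u)) (subst (tcomm f) t) := by
  rw [subst_subst, subst_subst]
  congr 1
  funext o
  cases o with
  | none => rfl
  | some a => exact (subst_sub1_shift (f a) _).symm

theorem subst_sub1_app1 {X : Type u} (t u : term X) :
    subst (sub1 u) (app1 t) = term.app t u := by
  simp only [app1, subst, subst_sub1_shift]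
  rfl

theorem subst_tcomm_app1 {X Y : Type u} (f : X → term Y) (t : term X) :
    subst (tcomm f) (app1 t) = app1 (subst f t) := by
  simp only [app1, subst, subst_tcomm_shift]
  rfl

/-! ### The relation `lcr` is a congruence stable under substitution -/

theorem lcr.refl {X : Type u} (t : term X) : lcr t t := by
  induction t with
  | var x => exact .var x
  | app t s iht ihs => exact .app iht ihs
  | abs t ih => exact .abs ih

theorem lcr.subst {X Y : Type u} (f : X → term Y) {x y : term X} (h : lcr x y) :
    lcr (subst f x) (subst f y) := by
  induction h generalizing Y with
  | var a => exact .refl _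
  | app _ _ ih₁ ih₂ => exact .app (ih₁ f) (ih₂ f)
  | abs _ ih => exact .abs (ih (tcomm f))
  | beta t u =>
    rw [subst_sub1]
    exact .beta _ _
  | eta t =>
    have h := lcr.eta (_root_.subst f t)
    rw [← subst_tcomm_shift] at h
    exact h
  | sym _ ih => exact (ih f).sym
  | trans _ _ ih₁ ih₂ => exact (ih₁ f).trans (ih₂ f)

theorem lcr.shift {X : Type u} {x y : term X} (h : lcr x y) :
    lcr (shift x) (shift y) := by
  simp only [_root_.shift, fct_eq_subst]
  exact h.subst _

theorem lcr.tcomm {X Y : Type u} {f g : X → term Y} (h : ∀ a, lcr (f a) (g a)) (o : Option X) :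
    lcr (tcomm f o) (tcomm g o) := by
  cases o with
  | none => exact .refl _
  | some a => exact (h a).shift

theorem lcr.subst_fun {X Y : Type u} {f g : X → term Y} (h : ∀ a, lcr (f a) (g a))
    (t : term X) : lcr (_root_.subst f t) (_root_.subst g t) := by
  induction t generalizing Y with
  | var x => exact h x
  | app t s iht ihs => exact .app (iht h) (ihs h)
  | abs t ih => exact .abs (ih (lcr.tcomm h))

theorem lcr.app1 {X : Type u} {x y : term X} (h : lcr x y) : lcr (app1 x) (app1 y) :=
  .app h.shift (.refl _)

theorem lcr.app1_abs {X : Type u} (t : term (Option X)) :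
    lcr (_root_.app1 (term.abs t)) t := by
  have h := lcr.beta (fct (Option.map some) t) (term.var (none : Option X))
  have e : sub1 (term.var (none : Option X)) ∘ Option.map some = term.var := by
    funext o
    cases o <;> rfl
  rwa [subst_fct, e, subst_var] at h

/-! ### The quotient monad -/

theorem lmk_eq_of_lcr {X : Type u} {x y : term X} (h : lcr x y) : lmk x = lmk y :=
  Quot.sound h

theorem lmk_eq_lmk_iff {X : Type u} {x y : term X} : lmk x = lmk y ↔ lcr x y :=
  ⟨Quotient.exact (s := ⟨lcr, ⟨lcr.refl, lcr.sym, lcr.trans⟩⟩), lmk_eq_of_lcr⟩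

theorem lmk_surjective {X : Type u} (x : Lam X) : ∃ t, lmk t = x :=
  Quot.exists_rep x

theorem exists_lmk_comp_eq {X Y : Type u} (f : X → Lam Y) :
    ∃ g : X → term Y, (fun u => lmk (g u)) = f :=
  ⟨fun u => (f u).out, funext fun u => (f u).out_eq⟩

noncomputable def Lam.bind (X Y : Type u) (f : X → Lam Y) : Lam X → Lam Y :=
  Quot.lift (fun t => lmk (subst (fun u => (f u).out) t)) fun _ _ h => lmk_eq_of_lcr (h.subst _)

def Lam.abs (X : Type u) : Lam (Option X) → Lam X :=
  Quot.lift (fun t => lmk (.abs t)) fun _ _ h => lmk_eq_of_lcr h.abs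

def Lam.app1 (X : Type u) : Lam X → Lam (Option X) :=
  Quot.lift (fun t => lmk (_root_.app1 t)) fun _ _ h => lmk_eq_of_lcr h.app1

theorem Lam.bind_lmk (X Y : Type u) (f : X → term Y) (x : term X) :
    Lam.bind X Y (fun u => lmk (f u)) (lmk x) = lmk (subst f x) :=
  lmk_eq_of_lcr (lcr.subst_fun (fun a => lmk_eq_lmk_iff.1 (Quot.out_eq (lmk (f a)))) x)

theorem Lam.comm_lmk {X Y : Type u} (f : X → term Y) :
    (fun o : Option X => Option.elim o (lmk (term.var none))
      (fun a => Lam.bind Y (Option Y) (fun y => lmk (term.var (some y))) (lmk (f a)))) =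
      fun o => lmk (tcomm f o) := by
  funext o
  cases o with
  | none => rfl
  | some a =>
    simp only [Option.elim, Lam.bind_lmk, tcomm, shift, fct_eq_subst]
    rfl

theorem Lam.bind_bind (X Y Z : Type u) (f : X → Lam Y) (g : Y → Lam Z) (x : Lam X) :
    Lam.bind Y Z g (Lam.bind X Y f x) =
      Lam.bind X Z (fun u => Lam.bind Y Z g (f u)) x := by
  obtain ⟨f, rfl⟩ := exists_lmk_comp_eq f
  obtain ⟨g, rfl⟩ := exists_lmk_comp_eq g
  obtain ⟨x, rfl⟩ := lmk_surjective x
  simp only [Lam.bind_lmk, subst_subst]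
  rfl

theorem Lam.bind_var (X Y : Type u) (f : X → Lam Y) (x : X) :
    Lam.bind X Y f (lmk (term.var x)) = f x := by
  obtain ⟨f, rfl⟩ := exists_lmk_comp_eq f
  exact Lam.bind_lmk X Y f _

theorem Lam.var_bind (X : Type u) (x : Lam X) :
    Lam.bind X X (fun u => lmk (term.var u)) x = x := by
  obtain ⟨x, rfl⟩ := lmk_surjective x
  rw [Lam.bind_lmk, subst_var]

theorem Lam.abs_bind (X Y : Type u) (f : X → Lam Y) (t : Lam (Option X)) :
    Lam.abs Y (Lam.bind (Option X) (Option Y)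
      (fun o => Option.elim o (lmk (term.var none))
        (fun a => Lam.bind Y (Option Y) (fun y => lmk (term.var (some y))) (f a))) t) =
      Lam.bind X Y f (Lam.abs X t) := by
  obtain ⟨f, rfl⟩ := exists_lmk_comp_eq f
  obtain ⟨t, rfl⟩ := lmk_surjective t
  rw [Lam.comm_lmk, Lam.bind_lmk]
  exact (Lam.bind_lmk X Y f (.abs t)).symm

theorem Lam.app1_bind (X Y : Type u) (f : X → Lam Y) (x : Lam X) :
    Lam.app1 Y (Lam.bind X Y f x) =
      Lam.bind (Option X) (Option Y)
        (fun o => Option.elim o (lmk (term.var none))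
          (fun a => Lam.bind Y (Option Y) (fun y => lmk (term.var (some y))) (f a)))
        (Lam.app1 X x) := by
  obtain ⟨f, rfl⟩ := exists_lmk_comp_eq f
  obtain ⟨x, rfl⟩ := lmk_surjective x
  rw [Lam.comm_lmk, Lam.bind_lmk]
  refine Eq.trans ?_ (Lam.bind_lmk _ _ (tcomm f) (_root_.app1 x)).symm
  rw [subst_tcomm_app1]
  rfl

theorem Lam.abs_app1 (X : Type u) (x : Lam X) : Lam.abs X (Lam.app1 X x) = x := by
  obtain ⟨x, rfl⟩ := lmk_surjective x
  exact lmk_eq_of_lcr (.eta x)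

theorem Lam.app1_abs (X : Type u) (t : Lam (Option X)) : Lam.app1 X (Lam.abs X t) = t := by
  obtain ⟨t, rfl⟩ := lmk_surjective t
  exact lmk_eq_of_lcr (.app1_abs t)

/-! ### Interpretation of terms in an exponential monad -/

/-- The map sending `none` to `u` and `some a` to the unit at `a`. -/
def MonadOn.sub1 (R : MonadOn.{u}) {X : Type u} (u : R.F X) : Option X → R.F X
  | none => u
  | some a => R.unit X a

theorem MonadOn.comm_unit_comp (R : MonadOn.{u}) {X Y : Type u} (f : X → Y) :
    R.comm (fun x => R.unit Y (f x)) = fun o => R.unit (Option Y) (Option.map f o) := by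
  funext o
  cases o with
  | none => rfl
  | some a => exact R.bind_unit _ _ _ _

theorem MonadOn.bind_sub1 (R : MonadOn.{u}) {X Y : Type u} (f : X → R.F Y) (u : R.F X)
    (t : R.F (Option X)) :
    R.bind X Y f (R.bind (Option X) X (R.sub1 u) t) =
      R.bind (Option Y) Y (R.sub1 (R.bind X Y f u))
        (R.bind (Option X) (Option Y) (R.comm f) t) := by
  rw [R.bind_bind, R.bind_bind]
  congr 1
  funext o
  cases o with
  | none => simp only [MonadOn.sub1, MonadOn.comm, R.bind_unit]
  | some a =>
    simp only [MonadOn.sub1, MonadOn.comm, R.bind_unit, R.bind_bind]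
    exact (R.unit_bind _ _).symm

section interp

variable (R : MonadOn.{u}) (absR : ∀ X : Type u, R.F (Option X) → R.F X)
  (app1R : ∀ X : Type u, R.F X → R.F (Option X))

def interp {X : Type u} : term X → R.F X
  | .var x => R.unit _ x
  | .app t s => R.bind _ _ (R.sub1 (interp s)) (app1R _ (interp t))
  | .abs t => absR _ (interp t)

variable {R absR app1R}

theorem interp_fct
    (habs : ∀ (X Y : Type u) (f : X → R.F Y) (t : R.F (Option X)),
      absR Y (R.bind (Option X) (Option Y) (R.comm f) t) = R.bind X Y f (absR X t))
    (happ : ∀ (X Y : Type u) (f : X → R.F Y) (t : R.F X),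
      app1R Y (R.bind X Y f t) = R.bind (Option X) (Option Y) (R.comm f) (app1R X t))
    {X Y : Type u} (f : X → Y) (t : term X) :
    interp R absR app1R (fct f t) =
      R.bind X Y (fun x => R.unit Y (f x)) (interp R absR app1R t) := by
  induction t generalizing Y with
  | var x => simp only [fct, interp, R.bind_unit]
  | app t s iht ihs => simp only [fct, interp, iht, ihs, happ, R.bind_sub1]
  | abs t ih => simp only [fct, interp, ih, ← habs, R.comm_unit_comp]

theorem interp_subst
    (habs : ∀ (X Y : Type u) (f : X → R.F Y) (t : R.F (Option X)),
      absR Y (R.bind (Option X) (Option Y) (R.comm f) t) = R.bind X Y f (absR X t))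
    (happ : ∀ (X Y : Type u) (f : X → R.F Y) (t : R.F X),
      app1R Y (R.bind X Y f t) = R.bind (Option X) (Option Y) (R.comm f) (app1R X t))
    {X Y : Type u} (f : X → term Y) (t : term X) :
    interp R absR app1R (subst f t) =
      R.bind X Y (fun x => interp R absR app1R (f x)) (interp R absR app1R t) := by
  induction t generalizing Y with
  | var x => simp only [subst, interp, R.bind_unit]
  | app t s iht ihs => simp only [subst, interp, iht, ihs, happ, R.bind_sub1]
  | abs t ih =>
    simp only [subst, interp, ih, ← habs]
    congr 2
    funext o
    cases o with
    | none => rfl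
    | some a => exact interp_fct habs happ some (f a)

theorem interp_app1
    (habs : ∀ (X Y : Type u) (f : X → R.F Y) (t : R.F (Option X)),
      absR Y (R.bind (Option X) (Option Y) (R.comm f) t) = R.bind X Y f (absR X t))
    (happ : ∀ (X Y : Type u) (f : X → R.F Y) (t : R.F X),
      app1R Y (R.bind X Y f t) = R.bind (Option X) (Option Y) (R.comm f) (app1R X t))
    {X : Type u} (t : term X) :
    interp R absR app1R (app1 t) = app1R X (interp R absR app1R t) := by
  simp only [app1, shift, interp, interp_fct habs happ, happ, R.comm_unit_comp, R.bind_bind,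
    R.bind_unit]
  refine Eq.trans ?_ (R.unit_bind _ _)
  congr 1
  funext o
  cases o <;> rfl

theorem interp_eq_of_lcr
    (habs : ∀ (X Y : Type u) (f : X → R.F Y) (t : R.F (Option X)),
      absR Y (R.bind (Option X) (Option Y) (R.comm f) t) = R.bind X Y f (absR X t))
    (happ : ∀ (X Y : Type u) (f : X → R.F Y) (t : R.F X),
      app1R Y (R.bind X Y f t) = R.bind (Option X) (Option Y) (R.comm f) (app1R X t))
    (heta : ∀ (X : Type u) (x : R.F X), absR X (app1R X x) = x)
    (hbeta : ∀ (X : Type u) (t : R.F (Option X)), app1R X (absR X t) = t)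
    {X : Type u} {x y : term X} (h : lcr x y) :
    interp R absR app1R x = interp R absR app1R y := by
  induction h with
  | var a => rfl
  | app _ _ ih₁ ih₂ => simp only [interp, ih₁, ih₂]
  | abs _ ih => simp only [interp, ih]
  | beta t u =>
    simp only [interp, interp_subst habs happ, hbeta]
    congr 1
    funext o
    cases o <;> rfl
  | eta t => exact (congrArg (absR _) (interp_app1 habs happ t)).trans (heta _ _)
  | sym _ ih => exact ih.symm
  | trans _ _ ih₁ ih₂ => exact ih₁.trans ih₂

/-- A morphism of monads commuting with abstraction and `app1` is determined on terms. -/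
theorem eq_interp {φ : ∀ X : Type u, Lam X → R.F X}
    (hvar : ∀ (X : Type u) (x : X), φ X (lmk (term.var x)) = R.unit X x)
    (hbind : ∀ (X Y : Type u) (f : X → Lam Y) (x : Lam X),
      φ Y (Lam.bind X Y f x) = R.bind X Y (fun u => φ Y (f u)) (φ X x))
    (habs : ∀ (X : Type u) (t : Lam (Option X)), φ X (Lam.abs X t) = absR X (φ (Option X) t))
    (happ : ∀ (X : Type u) (x : Lam X), φ (Option X) (Lam.app1 X x) = app1R X (φ X x))
    {X : Type u} (t : term X) : φ X (lmk t) = interp R absR app1R t := by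
  induction t with
  | var x => exact hvar _ x
  | app t s iht ihs =>
    rw [← subst_sub1_app1, ← Lam.bind_lmk, hbind, subst_sub1_app1]
    simp only [interp, ← iht, ← ihs, ← happ]
    congr 1
    funext o
    cases o with
    | none => rfl
    | some a => exact hvar _ a
  | abs t ih => exact (habs _ (lmk t)).trans (congrArg _ ih)

end interp

/-- Initiality of the semantic λ-calculus among exponential
monads: `Λ`, with the monad structure induced by `var` and `subst` and the
mutually inverse linear morphisms `abs̄` and `app1̄`, is an exponential monad,
and for every exponential monad `(R, absR, app1R)` there is a unique morphism
of monads `φ : Λ → R` commuting with abstraction and `app1`. -/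
theorem Lam_initial_exponential_monad :
    ∃ (sbind : ∀ X Y : Type u, (X → Lam Y) → Lam X → Lam Y)
      (absBar : ∀ X : Type u, Lam (Option X) → Lam X)
      (app1Bar : ∀ X : Type u, Lam X → Lam (Option X)),
      -- the structure is induced by `subst`, `abs` and `app1` on terms:
      (∀ (X Y : Type u) (f : X → term Y) (x : term X),
        sbind X Y (fun u => lmk (f u)) (lmk x) = lmk (subst f x)) ∧
      (∀ (X : Type u) (t : term (Option X)),
        absBar X (lmk t) = lmk (term.abs t)) ∧
      (∀ (X : Type u) (x : term X), app1Bar X (lmk x) = lmk (app1 x)) ∧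
      -- `Λ` is a monad (unit `x ↦ ⟦var x⟧`, bind `sbind`):
      (∀ (X Y Z : Type u) (f : X → Lam Y) (g : Y → Lam Z) (x : Lam X),
        sbind Y Z g (sbind X Y f x) =
          sbind X Z (fun u => sbind Y Z g (f u)) x) ∧
      (∀ (X Y : Type u) (f : X → Lam Y) (x : X),
        sbind X Y f (lmk (term.var x)) = f x) ∧
      (∀ (X : Type u) (x : Lam X),
        sbind X X (fun u => lmk (term.var u)) x = x) ∧
      -- `abs̄` and `app1̄` are Λ-linear (w.r.t. `comm` for the monad `Λ`):
      (∀ (X Y : Type u) (f : X → Lam Y) (t : Lam (Option X)),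
        absBar Y (sbind (Option X) (Option Y)
          (fun o => Option.elim o (lmk (term.var none))
            (fun a => sbind Y (Option Y)
              (fun y => lmk (term.var (some y))) (f a))) t) =
          sbind X Y f (absBar X t)) ∧
      (∀ (X Y : Type u) (f : X → Lam Y) (x : Lam X),
        app1Bar Y (sbind X Y f x) =
          sbind (Option X) (Option Y)
            (fun o => Option.elim o (lmk (term.var none))
              (fun a => sbind Y (Option Y)
                (fun y => lmk (term.var (some y))) (f a))) (app1Bar X x)) ∧
      -- `abs̄` and `app1̄` are mutually inverse:
      (∀ (X : Type u) (x : Lam X), absBar X (app1Bar X x) = x) ∧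
      (∀ (X : Type u) (t : Lam (Option X)), app1Bar X (absBar X t) = t) ∧
      -- initiality among exponential monads:
      (∀ (R : MonadOn.{u})
        (absR : ∀ X : Type u, R.F (Option X) → R.F X)
        (app1R : ∀ X : Type u, R.F X → R.F (Option X)),
        (∀ (X Y : Type u) (f : X → R.F Y) (t : R.F (Option X)),
          absR Y (R.bind (Option X) (Option Y) (R.comm f) t) =
            R.bind X Y f (absR X t)) →
        (∀ (X Y : Type u) (f : X → R.F Y) (t : R.F X),
          app1R Y (R.bind X Y f t) =
            R.bind (Option X) (Option Y) (R.comm f) (app1R X t)) →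
        (∀ (X : Type u) (x : R.F X), absR X (app1R X x) = x) →
        (∀ (X : Type u) (t : R.F (Option X)), app1R X (absR X t) = t) →
        ∃! φ : ∀ X : Type u, Lam X → R.F X,
          (∀ (X : Type u) (x : X), φ X (lmk (term.var x)) = R.unit X x) ∧
          (∀ (X Y : Type u) (f : X → Lam Y) (x : Lam X),
            φ Y (sbind X Y f x) = R.bind X Y (fun u => φ Y (f u)) (φ X x)) ∧
          (∀ (X : Type u) (t : Lam (Option X)),
            φ X (absBar X t) = absR X (φ (Option X) t)) ∧
          (∀ (X : Type u) (x : Lam X),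
            φ (Option X) (app1Bar X x) = app1R X (φ X x))) := by
  refine ⟨Lam.bind, Lam.abs, Lam.app1, Lam.bind_lmk, fun _ _ => rfl, fun _ _ => rfl,
    Lam.bind_bind, Lam.bind_var, Lam.var_bind, Lam.abs_bind, Lam.app1_bind, Lam.abs_app1,
    Lam.app1_abs, ?_⟩
  intro R absR app1R habs happ heta hbeta
  refine ⟨fun X => Quot.lift (interp R absR app1R)
    fun _ _ h => interp_eq_of_lcr habs happ heta hbeta h, ⟨fun _ _ => rfl, ?_, ?_, ?_⟩, ?_⟩
  · intro X Y f x
    obtain ⟨f, rfl⟩ := exists_lmk_comp_eq f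
    obtain ⟨x, rfl⟩ := lmk_surjective x
    rw [Lam.bind_lmk]
    exact interp_subst habs happ f x
  · intro X t
    obtain ⟨t, rfl⟩ := lmk_surjective t
    rfl
  · intro X x
    obtain ⟨x, rfl⟩ := lmk_surjective x
    exact interp_app1 habs happ x
  · rintro φ ⟨hvar, hbind, hφabs, hφapp⟩
    funext X x
    obtain ⟨t, rfl⟩ := lmk_surjective x
    exact eq_interp hvar hbind hφabs hφapp t
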